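/- (Theorem 3) For p = 2 and any odd integer q ≥ 5, A(2/q) = (1 + cos(π/q)) / (q cos(π/q)). -/

import Mathlib

open Real

/-- Membership in the Turán class `K(h)`, encoded via the nonnegative Fourier cosine
coefficient sequence `a` of a continuous 1-periodic even function
`f(x) = ∑' n, a n * cos (2πnx)`: all `a n ≥ 0`, `∑ a n = 1` (so `f 0 = 1`), and
`f x = 0` for `h ≤ |x| ≤ 1/2`. -/
def memK (h : ℝ) (a : ℕ → ℝ) : Prop :=
  (∀ n, 0 ≤ a n) ∧ Summable a ∧ (∑' n, a n) = 1 ∧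
    ∀ x : ℝ, h ≤ |x| → |x| ≤ 1 / 2 → (∑' n : ℕ, a n * Real.cos (2 * π * n * x)) = 0

/-- The Turán constant `A(h) = sup_{f ∈ K(h)} a₀`. -/
noncomputable def turanA (h : ℝ) : ℝ :=
  sSup {y : ℝ | ∃ a : ℕ → ℝ, memK h a ∧ y = a 0}

/-- The sum of `cos (2πmk/q)` over `k < q` is nonnegative: it equals `q` or `0`. -/
theorem sum_range_cos_nonneg (q : ℕ) (m : ℤ) :
    0 ≤ ∑ k ∈ Finset.range q, Real.cos (2 * π * m * (k / q)) := by
  rcases Nat.eq_zero_or_pos q with rfl | hq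
  · simp
  have hq' : (q : ℂ) ≠ 0 := by exact_mod_cast hq.ne'
  set w : ℂ := Complex.exp ((2 * π * m / q : ℝ) * Complex.I) with hw
  have hpow : ∀ k : ℕ, Real.cos (2 * π * m * (k / q)) = (w ^ k).re := by
    intro k
    rw [hw, ← Complex.exp_nat_mul, ← Complex.exp_ofReal_mul_I_re]
    congr 2
    push_cast
    ring
  have hwq : w ^ q = 1 := by
    rw [hw, ← Complex.exp_nat_mul, Complex.exp_eq_one_iff]
    refine ⟨m, ?_⟩
    push_cast
    field_simp
  simp_rw [hpow]
  rw [← Complex.re_sum]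
  by_cases h1 : w = 1
  · simp [h1]
  · rw [geom_sum_eq h1, hwq]
    simp

/-- The cosine sum is nonnegative after multiplication by another character. -/
theorem sum_range_cos_mul_cos_nonneg (q j n : ℕ) :
    0 ≤ ∑ k ∈ Finset.range q,
      Real.cos (2 * π * j * (k / q)) * Real.cos (2 * π * n * (k / q)) := by
  have h1 := sum_range_cos_nonneg q ((j : ℤ) - n)
  have h2 := sum_range_cos_nonneg q ((j : ℤ) + n)
  have h : ∑ k ∈ Finset.range q,
      Real.cos (2 * π * j * (k / q)) * Real.cos (2 * π * n * (k / q)) =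
      (∑ k ∈ Finset.range q, Real.cos (2 * π * ((j : ℤ) - n : ℤ) * (k / q)) +
        ∑ k ∈ Finset.range q, Real.cos (2 * π * ((j : ℤ) + n : ℤ) * (k / q))) / 2 := by
    rw [← Finset.sum_add_distrib, Finset.sum_div]
    refine Finset.sum_congr rfl fun k _ => ?_
    rw [show 2 * π * ((j : ℤ) - n : ℤ) * (k / q) =
        2 * π * j * (k / q) - 2 * π * n * (k / q) by push_cast; ring,
      show 2 * π * ((j : ℤ) + n : ℤ) * (k / q) =
        2 * π * j * (k / q) + 2 * π * n * (k / q) by push_cast; ring,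
      Real.cos_sub, Real.cos_add]
    ring
  rw [h]
  positivity

theorem summable_mul_cos {a : ℕ → ℝ} (ha : ∀ n, 0 ≤ a n) (hs : Summable a) (x : ℝ) :
    Summable fun n : ℕ => a n * Real.cos (2 * π * n * x) := by
  refine Summable.of_norm_bounded hs fun n => ?_
  rw [norm_mul, Real.norm_of_nonneg (ha n)]
  exact mul_le_of_le_one_right (ha n) (Real.abs_cos_le_one _)

/-- A cosine series is invariant under `x ↦ 1 - x`. -/
theorem cos_two_pi_mul_one_sub (n : ℕ) (x : ℝ) :
    Real.cos (2 * π * n * (1 - x)) = Real.cos (2 * π * n * x) := by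
  rw [show 2 * π * n * (1 - x) = n * (2 * π) - 2 * π * n * x by ring,
    Real.cos_nat_mul_two_pi_sub]

theorem memK.tsum_eq_zero {h : ℝ} {a : ℕ → ℝ} (ha : memK h a) {x : ℝ} (h0 : 0 ≤ x)
    (hx : h ≤ x) (hx' : h ≤ 1 - x) (h1 : x ≤ 1) :
    (∑' n : ℕ, a n * Real.cos (2 * π * n * x)) = 0 := by
  rcases le_total x (1 / 2) with hle | hle
  · exact ha.2.2.2 x (by rwa [abs_of_nonneg h0]) (by rwa [abs_of_nonneg h0])
  · have h0' : 0 ≤ 1 - x := by linarith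
    have := ha.2.2.2 (1 - x) (by rwa [abs_of_nonneg h0'])
      (by rw [abs_of_nonneg h0']; linarith)
    simpa only [cos_two_pi_mul_one_sub] using this

/-- Discrete Fourier transform of `k ↦ f (k/q)` for `f` in the class `K(2/q)`. -/
theorem memK.hasSum_discrete {q : ℕ} (hq : 5 ≤ q) {a : ℕ → ℝ} (ha : memK (2 / q) a) (j : ℕ) :
    HasSum (fun n => a n * ∑ k ∈ Finset.range q,
        Real.cos (2 * π * j * (k / q)) * Real.cos (2 * π * n * (k / q)))
      (1 + 2 * Real.cos (2 * π * j * (1 / q)) *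
        ∑' n : ℕ, a n * Real.cos (2 * π * n * (1 / q))) := by
  have hq0 : (0 : ℝ) < q := by positivity
  set F : ℝ → ℝ := fun x => ∑' n : ℕ, a n * Real.cos (2 * π * n * x) with hF
  have hsum : HasSum (fun n : ℕ => ∑ k ∈ Finset.range q,
      Real.cos (2 * π * j * (k / q)) * (a n * Real.cos (2 * π * n * (k / q))))
      (∑ k ∈ Finset.range q, Real.cos (2 * π * j * (k / q)) * F (k / q)) :=
    hasSum_sum fun k _ => (summable_mul_cos ha.1 ha.2.1 _).hasSum.mul_left _
  have hval : ∑ k ∈ Finset.range q, Real.cos (2 * π * j * (k / q)) * F (k / q) =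
      1 + 2 * Real.cos (2 * π * j * (1 / q)) * F (1 / q) := by
    have hsub : ({0, 1, q - 1} : Finset ℕ) ⊆ Finset.range q := by
      intro k hk
      simp only [Finset.mem_insert, Finset.mem_singleton] at hk
      rw [Finset.mem_range]
      omega
    rw [← Finset.sum_subset hsub]
    · have hlast : ((q - 1 : ℕ) : ℝ) / q = 1 - 1 / q := by
        rw [Nat.cast_sub (by omega)]
        field_simp
        simp
      have hF0 : F 0 = 1 := by simpa [hF] using ha.2.2.1
      have hF1 : F (1 - 1 / q) = F (1 / q) := by
        simp only [hF, cos_two_pi_mul_one_sub]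
      rw [Finset.sum_insert (by simp; omega), Finset.sum_insert (by simp; omega),
        Finset.sum_singleton, hlast, hF1, cos_two_pi_mul_one_sub]
      simp only [Nat.cast_zero, Nat.cast_one, zero_div, mul_zero, Real.cos_zero, hF0]
      ring
    · intro k hk hk'
      rw [Finset.mem_range] at hk
      simp only [Finset.mem_insert, Finset.mem_singleton, not_or] at hk'
      have h2 : (2 : ℝ) ≤ k := by exact_mod_cast (by omega : 2 ≤ k)
      have h3 : (k : ℝ) + 2 ≤ q := by exact_mod_cast (by omega : k + 2 ≤ q)
      have : F (k / q) = 0 := by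
        refine ha.tsum_eq_zero (by positivity) (by gcongr) ?_ ?_
        · rw [le_sub_iff_add_le, ← add_div, div_le_one hq0]
          linarith
        · rw [div_le_one hq0]
          linarith
      rw [this, mul_zero]
  rw [hval] at hsum
  convert hsum using 2 with n
  rw [Finset.mul_sum]
  exact Finset.sum_congr rfl fun k _ => by ring

theorem cos_pi_div_pos {q : ℕ} (hq : 5 ≤ q) : 0 < Real.cos (π / q) := by
  have hq' : (5 : ℝ) ≤ q := by exact_mod_cast hq
  apply Real.cos_pos_of_mem_Ioo
  constructor
  · have : 0 < π / q := by positivity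
    linarith [Real.pi_pos]
  · exact div_lt_div_of_pos_left Real.pi_pos (by norm_num) (by linarith)

theorem memK.apply_zero_le {q : ℕ} (hq : 5 ≤ q) (hodd : Odd q) {a : ℕ → ℝ}
    (ha : memK (2 / q) a) :
    a 0 ≤ (1 + Real.cos (π / q)) / (q * Real.cos (π / q)) := by
  have hq0 : (0 : ℝ) < q := by positivity
  have hc := cos_pi_div_pos hq
  have hterm : ∀ j n : ℕ, 0 ≤ a n * ∑ k ∈ Finset.range q,
      Real.cos (2 * π * j * (k / q)) * Real.cos (2 * π * n * (k / q)) :=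
    fun j n => mul_nonneg (ha.1 n) (sum_range_cos_mul_cos_nonneg q j n)
  set t := ∑' n : ℕ, a n * Real.cos (2 * π * n * (1 / q))
  obtain ⟨j, hj⟩ := hodd
  have hjcos : Real.cos (2 * π * j * (1 / q)) = -Real.cos (π / q) := by
    rw [← Real.cos_pi_sub]
    congr 1
    have : (q : ℝ) = 2 * j + 1 := by exact_mod_cast hj
    field_simp
    linarith
  have hj0 := (ha.hasSum_discrete hq j).nonneg (hterm j)
  rw [hjcos] at hj0
  have h0 := le_hasSum (ha.hasSum_discrete hq 0) 0 fun n _ => hterm 0 n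
  simp only [Nat.cast_zero, mul_zero, zero_mul, Real.cos_zero, mul_one, Finset.sum_const,
    Finset.card_range, nsmul_eq_mul] at h0
  rw [le_div_iff₀ (by positivity)]
  nlinarith [mul_le_mul_of_nonneg_right h0 hc.le]

/-- For odd `q`, the least value of `cos (2πn/q)` is `-cos (π/q)`. -/
theorem neg_cos_pi_div_le_cos {q : ℕ} (hodd : Odd q) (n : ℕ) :
    -Real.cos (π / q) ≤ Real.cos (2 * π * n * (1 / q)) := by
  have hqpos : 0 < q := hodd.pos
  have hq0 : (0 : ℝ) < q := by exact_mod_cast hqpos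
  have hlow : ∀ r : ℕ, 2 * r + 1 ≤ q → -Real.cos (π / q) ≤ Real.cos (2 * π * r * (1 / q)) := by
    intro r hr
    have hr' : (2 * r + 1 : ℝ) ≤ q := by exact_mod_cast hr
    have hle : 2 * π * r * (1 / q) ≤ π - π / q := by
      have : π * (2 * r + 1) / q ≤ π := by
        rw [div_le_iff₀ hq0]
        gcongr
      have e : 2 * π * r * (1 / q) + π / q = π * (2 * r + 1) / q := by ring
      linarith
    rw [← Real.cos_pi_sub]
    have : 0 < π / q := by positivity
    exact Real.cos_le_cos_of_nonneg_of_le_pi (by positivity) (by linarith) hle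
  have hmod : Real.cos (2 * π * n * (1 / q)) = Real.cos (2 * π * (n % q : ℕ) * (1 / q)) := by
    have h : (n : ℝ) = (n % q : ℕ) + q * (n / q : ℕ) := by exact_mod_cast (Nat.mod_add_div n q).symm
    rw [← Real.cos_add_nat_mul_two_pi (2 * π * (n % q : ℕ) * (1 / q)) (n / q), h]
    congr 1
    field_simp
  have hlt := Nat.mod_lt n hqpos
  obtain ⟨j, hj⟩ := hodd
  rw [hmod]
  rcases Nat.lt_or_ge (2 * (n % q)) q with h | h
  · exact hlow _ (by omega)
  · have := hlow (q - n % q) (by omega)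
    rw [Nat.cast_sub hlt.le] at this
    rw [← Real.cos_two_pi_sub (2 * π * (n % q : ℕ) * (1 / q))]
    refine this.trans_eq (congrArg Real.cos ?_)
    field_simp

/-- The Fourier series of the second Bernoulli polynomial on `[0, 1]`. -/
theorem hasSum_cos_div_sq {x : ℝ} (h0 : 0 ≤ x) (h1 : x ≤ 1) :
    HasSum (fun n : ℕ => 1 / (n : ℝ) ^ 2 * Real.cos (2 * π * n * x))
      (π ^ 2 * (x ^ 2 - x + 1 / 6)) := by
  have h := hasSum_one_div_nat_pow_mul_cos one_ne_zero (x := x) ⟨h0, h1⟩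
  have hB : (Polynomial.map (algebraMap ℚ ℝ) (Polynomial.bernoulli 2)).eval x =
      x ^ 2 - x + 1 / 6 := by
    simp [Polynomial.bernoulli, Finset.sum_range_succ, bernoulli_eq_bernoulli'_of_ne_one,
      bernoulli'_two, bernoulli_one, Polynomial.eval_monomial]
    ring
  simp only [mul_one] at h
  rw [hB] at h
  convert h using 1
  rw [Nat.factorial_two]
  push_cast
  ring

/-- Fourier coefficients of the piecewise linear function with nodes `k/q`, equal to `1` at `0`,
to `t` at `±1/q` and to `0` at the remaining nodes. -/
noncomputable def piecewiseLinearCoeff (q : ℕ) (t : ℝ) (n : ℕ) : ℝ :=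
  (if n = 0 then (1 + 2 * t) / q else 0) +
    q / π ^ 2 * (1 / (n : ℝ) ^ 2) *
      ((1 - Real.cos (2 * π * n * (1 / q))) * (1 + 2 * t * Real.cos (2 * π * n * (1 / q))))

theorem hasSum_piecewiseLinearCoeff (q : ℕ) (t x : ℝ) {g₀ g₁ g₁' g₂ g₂' : ℝ}
    (h₀ : HasSum (fun n : ℕ => 1 / (n : ℝ) ^ 2 * Real.cos (2 * π * n * x)) (π ^ 2 * g₀))
    (h₁ : HasSum (fun n : ℕ => 1 / (n : ℝ) ^ 2 * Real.cos (2 * π * n * (x + 1 / q)))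
      (π ^ 2 * g₁))
    (h₁' : HasSum (fun n : ℕ => 1 / (n : ℝ) ^ 2 * Real.cos (2 * π * n * (x - 1 / q)))
      (π ^ 2 * g₁'))
    (h₂ : HasSum (fun n : ℕ => 1 / (n : ℝ) ^ 2 * Real.cos (2 * π * n * (x + 2 / q)))
      (π ^ 2 * g₂))
    (h₂' : HasSum (fun n : ℕ => 1 / (n : ℝ) ^ 2 * Real.cos (2 * π * n * (x - 2 / q)))
      (π ^ 2 * g₂')) :
    HasSum (fun n : ℕ => piecewiseLinearCoeff q t n * Real.cos (2 * π * n * x))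
      ((1 + 2 * t) / q +
        q * ((1 - t) * g₀ + (2 * t - 1) / 2 * (g₁ + g₁') - t / 2 * (g₂ + g₂'))) := by
  have hδ : HasSum (fun n : ℕ => if n = 0 then (1 + 2 * t) / q else 0) ((1 + 2 * t) / q) :=
    hasSum_ite_eq 0 _
  have hmain := hδ.add ((((h₀.mul_left (1 - t)).add ((h₁.add h₁').mul_left ((2 * t - 1) / 2))).sub
    ((h₂.add h₂').mul_left (t / 2))).mul_left (q / π ^ 2))
  have hval : (1 + 2 * t) / q +
        q * ((1 - t) * g₀ + (2 * t - 1) / 2 * (g₁ + g₁') - t / 2 * (g₂ + g₂')) =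
      (1 + 2 * t) / q + q / π ^ 2 * ((1 - t) * (π ^ 2 * g₀) +
        (2 * t - 1) / 2 * (π ^ 2 * g₁ + π ^ 2 * g₁') - t / 2 * (π ^ 2 * g₂ + π ^ 2 * g₂')) := by
    field_simp
  rw [hval]
  refine hmain.congr_fun ?_
  intro n
  rw [piecewiseLinearCoeff, add_mul]
  congr 1
  · split_ifs with hn
    · simp [hn]
    · simp
  · rw [show 2 * π * n * (x + 1 / q) = 2 * π * n * x + 2 * π * n * (1 / q) by ring,
      show 2 * π * n * (x - 1 / q) = 2 * π * n * x - 2 * π * n * (1 / q) by ring,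
      show 2 * π * n * (x + 2 / q) = 2 * π * n * x + 2 * (2 * π * n * (1 / q)) by ring,
      show 2 * π * n * (x - 2 / q) = 2 * π * n * x - 2 * (2 * π * n * (1 / q)) by ring]
    simp only [Real.cos_add, Real.cos_sub, Real.cos_two_mul]
    ring

theorem hasSum_piecewiseLinearCoeff_zero {q : ℕ} (hq : 2 ≤ q) (t : ℝ) :
    HasSum (piecewiseLinearCoeff q t) 1 := by
  have hq' : (2 : ℝ) ≤ q := by exact_mod_cast hq
  have hq0 : (0 : ℝ) < q := by linarith
  have h1 : (1 : ℝ) / q ≤ 1 := by rw [div_le_one hq0]; linarith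
  have h2 : (2 : ℝ) / q ≤ 1 := by rwa [div_le_one hq0]
  have hneg : ∀ y : ℝ, 0 ≤ y → y ≤ 1 →
      HasSum (fun n : ℕ => 1 / (n : ℝ) ^ 2 * Real.cos (2 * π * n * (0 - y)))
        (π ^ 2 * (y ^ 2 - y + 1 / 6)) := by
    intro y hy hy'
    simpa only [zero_sub, mul_neg, Real.cos_neg] using hasSum_cos_div_sq hy hy'
  have h := hasSum_piecewiseLinearCoeff q t 0 (hasSum_cos_div_sq le_rfl zero_le_one)
    (hasSum_cos_div_sq (by positivity) (by simpa using h1)) (hneg _ (by positivity) h1)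
    (hasSum_cos_div_sq (by positivity) (by simpa using h2)) (hneg _ (by positivity) h2)
  simp only [mul_zero, Real.cos_zero, mul_one] at h
  convert h using 1
  field_simp
  ring

theorem hasSum_piecewiseLinearCoeff_eq_zero {q : ℕ} (hq : 0 < q) (t : ℝ) {x : ℝ}
    (hx : 2 / q ≤ x) (hx' : x + 2 / q ≤ 1) :
    HasSum (fun n : ℕ => piecewiseLinearCoeff q t n * Real.cos (2 * π * n * x)) 0 := by
  have hq0 : (0 : ℝ) < q := by exact_mod_cast hq
  have hpos : (0 : ℝ) < 1 / q := by positivity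
  have h2 : (2 : ℝ) / q = 2 * (1 / q) := by ring
  have h := hasSum_piecewiseLinearCoeff q t x (hasSum_cos_div_sq (by linarith) (by linarith))
    (hasSum_cos_div_sq (by linarith) (by linarith))
    (hasSum_cos_div_sq (by linarith) (by linarith))
    (hasSum_cos_div_sq (by linarith) (by linarith))
    (hasSum_cos_div_sq (by linarith) (by linarith))
  convert h using 1
  field_simp
  ring

theorem memK_piecewiseLinearCoeff {q : ℕ} (hq : 5 ≤ q) (hodd : Odd q) :
    memK (2 / q) (piecewiseLinearCoeff q (1 / (2 * Real.cos (π / q)))) := by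
  have hc := cos_pi_div_pos hq
  have hq' : (5 : ℝ) ≤ q := by exact_mod_cast hq
  have hone := hasSum_piecewiseLinearCoeff_zero (by omega : 2 ≤ q) (1 / (2 * Real.cos (π / q)))
  refine ⟨fun n => ?_, hone.summable, hone.tsum_eq, fun x hx hx' => ?_⟩
  · have hfactor : 0 ≤ 1 + 2 * (1 / (2 * Real.cos (π / q))) *
        Real.cos (2 * π * n * (1 / q)) := by
      have e : 1 + 2 * (1 / (2 * Real.cos (π / q))) * Real.cos (2 * π * n * (1 / q)) =
          (Real.cos (π / q) + Real.cos (2 * π * n * (1 / q))) / Real.cos (π / q) := by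
        field_simp
      rw [e]
      exact div_nonneg (by linarith [neg_cos_pi_div_le_cos hodd n]) hc.le
    have hsub : 0 ≤ 1 - Real.cos (2 * π * n * (1 / q)) := by
      linarith [Real.cos_le_one (2 * π * n * (1 / q))]
    unfold piecewiseLinearCoeff
    refine add_nonneg ?_ (mul_nonneg (by positivity) (mul_nonneg hsub hfactor))
    split_ifs <;> positivity
  · have h2 : (2 : ℝ) / q ≤ 1 / 2 := by
      rw [div_le_div_iff₀ (by linarith) (by norm_num)]
      linarith
    have habs : ∀ n : ℕ, Real.cos (2 * π * n * x) = Real.cos (2 * π * n * |x|) := by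
      intro n
      rcases abs_choice x with h | h <;> simp [h]
    simp only [habs]
    exact (hasSum_piecewiseLinearCoeff_eq_zero (by omega) _ hx (by linarith)).tsum_eq

/-- Theorem 3: for `p = 2` and odd `q ≥ 5`,
`A(2/q) = (1 + cos (π/q)) / (q cos (π/q))`. -/
theorem turanA_two_div (q : ℕ) (hq : 5 ≤ q) (hodd : Odd q) :
    turanA (2 / q) = (1 + Real.cos (π / q)) / (q * Real.cos (π / q)) := by
  refine IsGreatest.csSup_eq ⟨⟨_, memK_piecewiseLinearCoeff hq hodd, ?_⟩, ?_⟩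
  · have hc := cos_pi_div_pos hq
    have hq0 : (0 : ℝ) < q := by positivity
    simp only [piecewiseLinearCoeff, if_true, Nat.cast_zero, mul_zero, zero_mul, Real.cos_zero,
      sub_self, add_zero]
    field_simp
    ring
  · rintro _ ⟨a, ha, rfl⟩
    exact ha.apply_zero_le hq hodd
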